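/- Let {K^i}_{i=1}^k be matrices on an N-dimensional Hilbert space satisfying ∑ᵢ K^{i†}K^i = I, and let ρ be a density matrix. Define p_i = Tr(K^i ρ K^{i†}), ρ_i = K^i ρ K^{i†}/p_i (for p_i > 0), and the correlation matrix σ with entries σ_{ij} = Tr(K^i ρ K^{j†}). Then the Holevo quantity satisfies χ({p_i, ρ_i}) = S(∑ᵢ pᵢρᵢ) − ∑ᵢ pᵢ S(ρᵢ) ≤ S(σ). -/

import Mathlib

open Matrix
open scoped ComplexOrder

/-- Von Neumann entropy of a Hermitian matrix via its eigenvalues. -/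
noncomputable def vnEntropy {n : Type*} [Fintype n] [DecidableEq n]
    {A : Matrix n n ℂ} (hA : A.IsHermitian) : ℝ :=
  -∑ i, hA.eigenvalues i * Real.log (hA.eigenvalues i)

theorem aux_log {ι κ : Type*} [Fintype ι] [Fintype κ] (α x : ι → ℝ) (β y : κ → ℝ)
    (hx : ∀ i, α i ≠ 0 → 0 < x i) (hy : ∀ i, β i ≠ 0 → 0 < y i)
    (hs : ∑ i, α i = ∑ k, β k)
    (h : ∀ t : ℝ, 0 < t → ∑ i, α i / (x i + t) ≤ ∑ k, β k / (y k + t)) :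
    ∑ k, β k * Real.log (y k) ≤ ∑ i, α i * Real.log (x i) := by
  have key : ∀ (a z : ℝ), (a ≠ 0 → 0 < z) → ∀ t : ℝ, 0 ≤ t →
      HasDerivAt (fun t => a * Real.log (z + t)) (a / (z + t)) t := by
    intro a z hz t ht
    by_cases ha : a = 0
    · subst ha
      simpa using hasDerivAt_const t (0:ℝ)
    · have hz := hz ha
      have := (((hasDerivAt_id t).const_add z).log (by simp; linarith)).const_mul a
      simpa [div_eq_mul_inv] using this
  have lim : ∀ (a z : ℝ), Filter.Tendsto (fun t : ℝ => a * (Real.log (z + t) - Real.log t))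
      Filter.atTop (nhds 0) := by
    intro a z
    have := (Real.tendsto_log_comp_add_sub_log z).const_mul a
    simpa [add_comm] using this
  let f : ℝ → ℝ := fun t => ∑ i, α i * Real.log (x i + t) - ∑ k, β k * Real.log (y k + t)
  have hd : ∀ t : ℝ, 0 ≤ t → HasDerivAt f (∑ i, α i / (x i + t) - ∑ k, β k / (y k + t)) t := by
    intro t ht
    exact (HasDerivAt.fun_sum fun i _ => key _ _ (hx i) t ht).sub
      (HasDerivAt.fun_sum fun i _ => key _ _ (hy i) t ht)
  have anti : AntitoneOn f (Set.Ici 0) := by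
    apply antitoneOn_of_deriv_nonpos (convex_Ici 0)
    · intro t ht
      exact (hd t ht).continuousAt.continuousWithinAt
    · intro t ht
      rw [interior_Ici] at ht
      exact (hd t (le_of_lt ht)).differentiableAt.differentiableWithinAt
    · intro t ht
      rw [interior_Ici] at ht
      rw [(hd t (le_of_lt ht)).deriv]
      linarith [h t ht]
  have hlim : Filter.Tendsto f Filter.atTop (nhds 0) := by
    have h1 : Filter.Tendsto (fun t : ℝ => ∑ i, α i * (Real.log (x i + t) - Real.log t)
        - ∑ k, β k * (Real.log (y k + t) - Real.log t)) Filter.atTop (nhds (∑ i : ι, 0 - ∑ k : κ, 0)) :=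
      (tendsto_finsetSum _ fun i _ => lim _ _).sub (tendsto_finsetSum _ fun i _ => lim _ _)
    simp only [Finset.sum_const_zero, sub_zero] at h1
    refine h1.congr fun t => ?_
    simp only [mul_sub, Finset.sum_sub_distrib, ← Finset.sum_mul, hs, f]
    ring
  have h0 : 0 ≤ f 0 := by
    refine le_of_tendsto hlim ?_
    filter_upwards [Filter.eventually_ge_atTop 0] with t ht
    exact anti (by simp) ht ht
  simp only [f, add_zero] at h0
  linarith

theorem aux_spec {n : Type*} [Fintype n] [DecidableEq n] {A : Matrix n n ℂ} (hA : A.IsHermitian) :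
    ∃ U : Matrix n n ℂ, Uᴴ * U = 1 ∧ U * Uᴴ = 1 ∧
      A = U * diagonal (fun i => (hA.eigenvalues i : ℂ)) * Uᴴ := by
  refine ⟨hA.eigenvectorUnitary, ?_, ?_, ?_⟩
  · exact Unitary.coe_star_mul_self hA.eigenvectorUnitary
  · exact Unitary.coe_mul_star_self hA.eigenvectorUnitary
  · exact hA.spectral_theorem

theorem aux_real (U ζ : ℂ) (l t : ℝ) (hl : 0 ≤ l) (ht : 0 < t) :
    2 * (U * ζ).re - ‖ζ‖^2 - t * (2 * (U * ζ).re / (l + t) - l * (‖U‖ / (l+t))^2)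
      ≤ ‖U‖^2 * l / (l + t) := by
  have h1 : (U * ζ).re ≤ ‖U‖ * ‖ζ‖ := by
    rw [← norm_mul]; exact Complex.re_le_norm _
  have hp : 0 < l + t := by linarith
  have e : 2 * (U * ζ).re - ‖ζ‖^2 - t * (2 * (U * ζ).re / (l + t) - l * (‖U‖ / (l+t))^2)
     = ‖U‖^2 * l / (l + t) - (‖U‖ * (l/(l+t)) - ‖ζ‖)^2 - 2 * (l / (l+t)) * (‖U‖ * ‖ζ‖ - (U * ζ).re) := by
    field_simp
    ring
  rw [e]
  have : 0 ≤ 2 * (l / (l+t)) * (‖U‖ * ‖ζ‖ - (U * ζ).re) := by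
    apply mul_nonneg (by positivity); linarith
  nlinarith [sq_nonneg (‖U‖ * (l/(l+t)) - ‖ζ‖)]

theorem aux_dot {m : Type*} [Fintype m] (z : m → ℂ) : star z ⬝ᵥ z = ((∑ j, ‖z j‖^2 : ℝ) : ℂ) := by
  simp [dotProduct, Complex.conj_mul']

theorem aux_B {k m : Type*} [Fintype k] [DecidableEq k] [Fintype m]
    (Y : Matrix k m ℂ) (U : Matrix k k ℂ) (l : k → ℝ) (hl : ∀ c, 0 ≤ l c)
    (hU' : Uᴴ * U = 1) (hU : U * Uᴴ = 1) (hY : Y * Yᴴ = U * diagonal (fun c => (l c : ℂ)) * Uᴴ)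
    (z : m → ℂ) (t : ℝ) (ht : 0 < t) (i : k) :
    2 * ((Y *ᵥ z) i).re - ∑ j, ‖(Y *ᵥ z) j‖^2 - t * ∑ j, ‖z j‖^2 ≤
      ∑ c, ‖U i c‖^2 * l c / (l c + t) := by
  set W := Uᴴ * Y with hW
  have hYW : Y = U * W := by rw [hW, ← Matrix.mul_assoc, hU, Matrix.one_mul]
  have hWW : W * Wᴴ = diagonal (fun c => (l c : ℂ)) := by
    rw [hW, conjTranspose_mul, conjTranspose_conjTranspose, Matrix.mul_assoc, ← Matrix.mul_assoc Y,
      hY]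
    simp only [← Matrix.mul_assoc, hU', Matrix.one_mul]
    rw [Matrix.mul_assoc, hU', Matrix.mul_one]
  set ζ := W *ᵥ z with hζ
  have h1 : Y *ᵥ z = U *ᵥ ζ := by rw [hζ, mulVec_mulVec, ← hYW]
  have h2 : ∑ j, ‖(Y *ᵥ z) j‖^2 = ∑ c, ‖ζ c‖^2 := by
    have : star (U *ᵥ ζ) ⬝ᵥ (U *ᵥ ζ) = star ζ ⬝ᵥ ζ := by
      rw [star_mulVec, ← dotProduct_mulVec, mulVec_mulVec, hU', one_mulVec]
    rw [aux_dot, aux_dot] at this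
    rw [h1]; exact_mod_cast this
  have h3 : ((Y *ᵥ z) i).re = ∑ c, (U i c * ζ c).re := by
    rw [h1]; simp [mulVec, dotProduct]
  let g : k → ℂ := fun c => star (U i c) / ((l c + t : ℝ) : ℂ)
  have h4 : 0 ≤ ∑ j, ‖z j‖^2 - ∑ c, (2 * (U i c * ζ c).re / (l c + t) - l c * (‖U i c‖ / (l c+t))^2) := by
    have e : star (z - Wᴴ *ᵥ g) ⬝ᵥ (z - Wᴴ *ᵥ g) = star z ⬝ᵥ z - star (star g ⬝ᵥ ζ) - star g ⬝ᵥ ζ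
        + star g ⬝ᵥ ((W * Wᴴ) *ᵥ g) := by
      have e1 : star (Wᴴ *ᵥ g) = star g ᵥ* W := by rw [star_mulVec, conjTranspose_conjTranspose]
      have e2 : star z ⬝ᵥ (Wᴴ *ᵥ g) = star (star g ⬝ᵥ ζ) := by
        rw [← star_dotProduct_star, star_star, hζ, star_mulVec, dotProduct_comm, ← dotProduct_mulVec,
          dotProduct_comm]
      rw [star_sub, sub_dotProduct, dotProduct_sub, dotProduct_sub, e1, e2, ← dotProduct_mulVec,
        ← dotProduct_mulVec, mulVec_mulVec, ← hζ]
      ring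
    rw [hWW, aux_dot, aux_dot] at e
    have e' := congrArg Complex.re e
    have hg : star g ⬝ᵥ ζ = ∑ c, U i c * ζ c / ((l c + t : ℝ) : ℂ) := by
      simp only [dotProduct, g]
      refine Finset.sum_congr rfl fun c _ => ?_
      simp only [Pi.star_apply, star_div₀, Complex.star_def, Complex.conj_conj, Complex.conj_ofReal]
      ring
    have hg2 : star g ⬝ᵥ (diagonal (fun c => (l c : ℂ)) *ᵥ g) =
        ((∑ c, l c * (‖U i c‖ / (l c+t))^2 : ℝ) : ℂ) := by
      simp only [dotProduct, mulVec_diagonal]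
      push_cast
      refine Finset.sum_congr rfl fun c _ => ?_
      have : ((‖U i c‖ : ℂ) / (l c + t))^2 = (‖g c‖ : ℂ)^2 := by
        have hp : 0 < l c + t := by linarith [hl c]
        have : ‖g c‖ = ‖U i c‖ / (l c + t) := by
          simp only [g, norm_div, norm_star, Complex.norm_real, Real.norm_eq_abs, abs_of_pos hp]
        rw [this]; push_cast; ring
      rw [this, ← Complex.conj_mul']
      simp only [Pi.star_apply, Complex.star_def]
      ring
    rw [hg2, hg] at e'
    simp only [Complex.add_re, Complex.sub_re, Complex.ofReal_re, Complex.star_def, Complex.conj_re,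
      Complex.re_sum, Complex.div_ofReal_re] at e'
    have : 0 ≤ ∑ j, ‖(z - Wᴴ *ᵥ g) j‖^2 := by positivity
    rw [e'] at this
    rw [Finset.sum_sub_distrib]
    have e3 : ∑ c, 2 * (U i c * ζ c).re / (l c + t) = 2 * ∑ c, (U i c * ζ c).re / (l c + t) := by
      rw [Finset.mul_sum]; simp only [mul_div_assoc]
    rw [e3]; linarith
  have h5 := Finset.sum_le_sum fun c (_ : c ∈ Finset.univ) => aux_real (U i c) (ζ c) (l c) t (hl c) ht
  rw [Finset.sum_sub_distrib, Finset.sum_sub_distrib, ← Finset.mul_sum, ← Finset.mul_sum] at h5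
  rw [h2, h3]
  have := mul_nonneg ht.le h4
  linarith

theorem aux_tr {n : Type*} [Fintype n] (A B : Matrix n n ℂ) :
    (A * Bᴴ).trace = ∑ q : n × n, A q.1 q.2 * star (B q.1 q.2) := by
  rw [Fintype.sum_prod_type]
  simp [Matrix.trace, Matrix.mul_apply]

theorem aux_trn {n : Type*} [Fintype n] (A : Matrix n n ℂ) :
    (A * Aᴴ).trace.re = ∑ q : n × n, ‖A q.1 q.2‖^2 := by
  rw [aux_tr, Complex.re_sum]
  refine Finset.sum_congr rfl fun q _ => ?_
  rw [Complex.star_def, Complex.mul_conj']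
  norm_cast

theorem aux_cs {n : Type*} [Fintype n] (A B : Matrix n n ℂ) :
    ‖(A * Bᴴ).trace‖^2 ≤ (A * Aᴴ).trace.re * (B * Bᴴ).trace.re := by
  rw [aux_trn, aux_trn, aux_tr]
  refine le_trans ?_ (Finset.sum_mul_sq_le_sq_mul_sq _ _ _)
  refine pow_le_pow_left₀ (norm_nonneg _) ?_ 2
  refine (norm_sum_le _ _).trans (le_of_eq ?_)
  simp

theorem aux_C {k n : Type*} [Fintype k] [DecidableEq k] [Fintype n] [DecidableEq n]
    (Y : k → Matrix n n ℂ) (σ U : Matrix k k ℂ) (l : k → ℝ) (hl : ∀ c, 0 ≤ l c)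
    (hU' : Uᴴ * U = 1) (hU : U * Uᴴ = 1) (hσ : ∀ i j, σ i j = (Y i * (Y j)ᴴ).trace)
    (hY : σ = U * diagonal (fun c => (l c : ℂ)) * Uᴴ)
    (M R X : Matrix n n ℂ) (hM : M = ∑ j, Y j * (Y j)ᴴ) (p t : ℝ) (i : k) (ht : 0 < t)
    (hR : Y i * (Y i)ᴴ = (p : ℂ) • R) (hR1 : R.trace = 1) (hX : M * X + (t : ℂ) • (X * R) = R) :
    p * (Xᴴ * R).trace.re ≤ ∑ c, ‖U i c‖^2 * l c / (l c + t) := by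
  let 𝒴 : Matrix k (n × n) ℂ := of fun j q => Y j q.1 q.2
  let z : n × n → ℂ := fun q => star ((X * Y i) q.1 q.2)
  have h𝒴 : 𝒴 * 𝒴ᴴ = U * diagonal (fun c => (l c : ℂ)) * Uᴴ := by
    rw [← hY]
    ext a b
    rw [hσ, aux_tr]
    simp [Matrix.mul_apply, 𝒴]
  have h := aux_B 𝒴 U l hl hU' hU h𝒴 z t ht i
  have hz : ∀ j, (𝒴 *ᵥ z) j = (Y j * (X * Y i)ᴴ).trace := by
    intro j
    rw [aux_tr]
    simp [mulVec, dotProduct, 𝒴, z]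
  have hp : (Y i * (Y i)ᴴ).trace.re = p := by rw [hR]; simp [hR1]
  have h1 : ((𝒴 *ᵥ z) i).re = p * (Xᴴ * R).trace.re := by
    rw [hz, conjTranspose_mul, ← Matrix.mul_assoc, hR, trace_mul_comm]
    simp
  have h2 : ∑ q, ‖z q‖^2 = p * (X * R * Xᴴ).trace.re := by
    have : ∑ q, ‖z q‖^2 = ((X * Y i) * (X * Y i)ᴴ).trace.re := by
      rw [aux_trn]; simp [z]
    rw [this, conjTranspose_mul, Matrix.mul_assoc, ← Matrix.mul_assoc (Y i), hR]
    simp [Matrix.mul_assoc]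
  have h3 : ∑ j, ‖(𝒴 *ᵥ z) j‖^2 ≤ p * (Xᴴ * M * X).trace.re := by
    have e : p * (Xᴴ * M * X).trace.re = ∑ j, ((Xᴴ * Y j) * (Xᴴ * Y j)ᴴ).trace.re * (Y i * (Y i)ᴴ).trace.re := by
      rw [hp, ← Finset.sum_mul, mul_comm, hM, Matrix.mul_sum, Matrix.sum_mul, trace_sum, Complex.re_sum]
      congr 1
      refine Finset.sum_congr rfl fun j _ => ?_
      rw [conjTranspose_mul, conjTranspose_conjTranspose]
      simp only [Matrix.mul_assoc]
    rw [e]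
    refine Finset.sum_le_sum fun j _ => ?_
    refine le_trans (le_of_eq ?_) (aux_cs _ _)
    rw [hz, conjTranspose_mul, ← Matrix.mul_assoc, trace_mul_comm, Matrix.mul_assoc]
  have h4 : (Xᴴ * R).trace.re = (Xᴴ * M * X).trace.re + t * (X * R * Xᴴ).trace.re := by
    conv_lhs => rw [← hX]
    rw [Matrix.mul_add, trace_add, Complex.add_re, ← Matrix.mul_assoc, trace_mul_comm (X * R)]
    simp
  rw [h1, h2] at h
  have : p * (Xᴴ * R).trace.re = p * (Xᴴ * M * X).trace.re + t * (p * (X * R * Xᴴ).trace.re) := by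
    rw [h4]; ring
  linarith

theorem aux_D {k n : Type*} [Fintype k] [DecidableEq k] [Fintype n] [DecidableEq n]
    (Y : k → Matrix n n ℂ) (σ U : Matrix k k ℂ) (l : k → ℝ) (hl : ∀ c, 0 ≤ l c)
    (hU' : Uᴴ * U = 1) (hU : U * Uᴴ = 1) (hσ : ∀ i j, σ i j = (Y i * (Y j)ᴴ).trace)
    (hY : σ = U * diagonal (fun c => (l c : ℂ)) * Uᴴ)
    (M R Q V : Matrix n n ℂ) (hM : M = ∑ j, Y j * (Y j)ᴴ) (p t : ℝ) (i : k) (ht : 0 < t)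
    (hR : Y i * (Y i)ᴴ = (p : ℂ) • R) (hR1 : R.trace = 1)
    (s e : n → ℝ) (hs : ∀ a, 0 ≤ s a) (he : ∀ b, 0 ≤ e b)
    (hQ' : Qᴴ * Q = 1) (hQ : Q * Qᴴ = 1) (hV' : Vᴴ * V = 1)
    (hMQ : M = Q * diagonal (fun c => (s c : ℂ)) * Qᴴ)
    (hRV : R = V * diagonal (fun c => (e c : ℂ)) * Vᴴ) :
    p * ∑ a, ∑ b, ‖(Qᴴ * V) a b‖^2 * e b ^ 2 / (s a + t * e b) ≤
      ∑ c, ‖U i c‖^2 * l c / (l c + t) := by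
  set T := Qᴴ * V with hT
  let x : Matrix n n ℂ := of fun a b => T a b * ((e b / (s a + t * e b) : ℝ) : ℂ)
  have hx : diagonal (fun c => (s c : ℂ)) * x + (t : ℂ) • (x * diagonal (fun c => (e c : ℂ))) =
      T * diagonal (fun c => (e c : ℂ)) := by
    ext a b
    simp only [Matrix.add_apply, Matrix.smul_apply, diagonal_mul, mul_diagonal, smul_eq_mul, x, of_apply]
    by_cases h0 : s a + t * e b = 0
    · have : e b = 0 := by
        have h1 := mul_nonneg ht.le (he b)
        have h2 := hs a
        have : t * e b = 0 := by linarith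
        rcases mul_eq_zero.mp this with h | h
        · exact absurd h ht.ne'
        · exact h
      simp [this]
    · have h0' : ((s a : ℂ) + e b * t) ≠ 0 := by
        rw [mul_comm t (e b)] at h0
        exact_mod_cast h0
      rw [mul_comm t (e b)]
      push_cast
      field_simp
  have hX : M * (Q * x * Vᴴ) + (t : ℂ) • ((Q * x * Vᴴ) * R) = R := by
    have e1 : M * (Q * x * Vᴴ) = Q * (diagonal (fun c => (s c : ℂ)) * x) * Vᴴ := by
      rw [hMQ]
      calc _ = Q * diagonal (fun c => (s c : ℂ)) * (Qᴴ * Q) * x * Vᴴ := by simp only [Matrix.mul_assoc]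
        _ = _ := by rw [hQ']; simp only [Matrix.mul_assoc, Matrix.one_mul]
    have e2 : (Q * x * Vᴴ) * R = Q * (x * diagonal (fun c => (e c : ℂ))) * Vᴴ := by
      rw [hRV]
      calc _ = Q * x * (Vᴴ * V) * diagonal (fun c => (e c : ℂ)) * Vᴴ := by simp only [Matrix.mul_assoc]
        _ = _ := by rw [hV']; simp only [Matrix.mul_assoc, Matrix.one_mul]
    have e3 : R = Q * (T * diagonal (fun c => (e c : ℂ))) * Vᴴ := by
      rw [hRV, hT]
      simp only [← Matrix.mul_assoc, hQ, Matrix.one_mul]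
    rw [e1, e2]
    conv_rhs => rw [e3, ← hx]
    simp [Matrix.mul_add, Matrix.add_mul]
  have h := aux_C Y σ U l hl hU' hU hσ hY M R (Q * x * Vᴴ) hM p t i ht hR hR1 hX
  refine le_trans (le_of_eq ?_) h
  congr 1
  have e1 : ((Q * x * Vᴴ)ᴴ * R).trace = (T * diagonal (fun c => (e c : ℂ)) * xᴴ).trace := by
    rw [hRV, hT]
    simp only [conjTranspose_mul, conjTranspose_conjTranspose]
    calc _ = (V * (xᴴ * Qᴴ * V * diagonal (fun c => (e c : ℂ)) * Vᴴ)).trace := by simp only [Matrix.mul_assoc]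
      _ = (xᴴ * Qᴴ * V * diagonal (fun c => (e c : ℂ)) * (Vᴴ * V)).trace := by
        rw [trace_mul_comm]; simp only [Matrix.mul_assoc]
      _ = (xᴴ * (Qᴴ * V * diagonal (fun c => (e c : ℂ)))).trace := by
        rw [hV', Matrix.mul_one]; simp only [Matrix.mul_assoc]
      _ = _ := by rw [trace_mul_comm]
  rw [e1, aux_tr, Fintype.sum_prod_type, Complex.re_sum]
  refine Finset.sum_congr rfl fun a _ => ?_
  rw [Complex.re_sum]
  refine Finset.sum_congr rfl fun b _ => ?_
  have : (T * diagonal (fun c => (e c : ℂ))) a b * star (x a b) =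
      ((‖T a b‖^2 * e b ^ 2 / (s a + t * e b) : ℝ) : ℂ) := by
    simp only [x, of_apply, mul_diagonal, star_mul', Complex.star_def, Complex.conj_ofReal]
    push_cast
    rw [← Complex.mul_conj']
    ring
  simp only [this, Complex.ofReal_re]

theorem aux_diag {n m : Type*} [Fintype n] [DecidableEq n] [Fintype m] (T : Matrix m n ℂ) (d : n → ℝ) (a : m) :
    (T * diagonal (fun c => (d c : ℂ)) * Tᴴ) a a = ((∑ b, ‖T a b‖^2 * d b : ℝ) : ℂ) := by
  rw [Matrix.mul_apply]
  push_cast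
  refine Finset.sum_congr rfl fun b _ => ?_
  rw [mul_diagonal, conjTranspose_apply, Complex.star_def, ← Complex.mul_conj']
  ring

theorem aux_row {n m : Type*} [Fintype n] [DecidableEq n] [Fintype m] [DecidableEq m] (T : Matrix m n ℂ)
    (hT : T * Tᴴ = 1) (a : m) : ∑ b, ‖T a b‖^2 = 1 := by
  have := aux_diag T (fun _ => 1) a
  simp [hT] at this
  exact_mod_cast this.symm

theorem aux_col {n m : Type*} [Fintype n] [DecidableEq n] [Fintype m] [DecidableEq m] (T : Matrix m n ℂ)
    (hT : Tᴴ * T = 1) (b : n) : ∑ a, ‖T a b‖^2 = 1 := by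
  have := aux_row Tᴴ (by simpa using hT) b
  simpa using this

theorem holevo_le_entropy_correlation_matrix {k N : ℕ}
    (K : Fin k → Matrix (Fin N) (Fin N) ℂ)
    (hK : ∑ i, (K i)ᴴ * K i = 1)
    (ρ : Matrix (Fin N) (Fin N) ℂ) (hρ : ρ.PosSemidef) (hρtr : ρ.trace = 1)
    (p : Fin k → ℝ) (hp : ∀ i, (p i : ℂ) = (K i * ρ * (K i)ᴴ).trace)
    (ρi : Fin k → Matrix (Fin N) (Fin N) ℂ)
    (hρidef : ∀ i, p i ≠ 0 → ρi i = ((p i : ℂ))⁻¹ • (K i * ρ * (K i)ᴴ))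
    (hρiH : ∀ i, (ρi i).IsHermitian)
    (σ : Matrix (Fin k) (Fin k) ℂ)
    (hσdef : ∀ i j, σ i j = (K i * ρ * (K j)ᴴ).trace)
    (hσ : σ.IsHermitian)
    (avg : Matrix (Fin N) (Fin N) ℂ)
    (havgdef : avg = ∑ i, (p i : ℂ) • ρi i)
    (havg : avg.IsHermitian) :
    vnEntropy havg - ∑ i, p i * vnEntropy (hρiH i) ≤ vnEntropy hσ := by
  obtain ⟨C, hC⟩ : ∃ C : Matrix (Fin N) (Fin N) ℂ, ρ = C * Cᴴ := by
    obtain ⟨V, hV', hV, hVR⟩ := aux_spec hρ.isHermitian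
    refine ⟨V * diagonal (fun b => ((Real.sqrt (hρ.isHermitian.eigenvalues b) : ℝ) : ℂ)), ?_⟩
    have hd : diagonal (fun b => ((Real.sqrt (hρ.isHermitian.eigenvalues b) : ℝ) : ℂ)) *
        (diagonal (fun b => ((Real.sqrt (hρ.isHermitian.eigenvalues b) : ℝ) : ℂ)))ᴴ =
        diagonal (fun b => (hρ.isHermitian.eigenvalues b : ℂ)) := by
      rw [diagonal_conjTranspose, diagonal_mul_diagonal]
      congr 1
      funext b
      rw [Pi.star_apply, Complex.star_def, Complex.conj_ofReal, ← Complex.ofReal_mul,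
        Real.mul_self_sqrt (hρ.eigenvalues_nonneg b)]
    rw [conjTranspose_mul, Matrix.mul_assoc, ← Matrix.mul_assoc _ _ Vᴴ, hd, ← Matrix.mul_assoc]
    exact hVR
  let Y : Fin k → Matrix (Fin N) (Fin N) ℂ := fun i => K i * C
  have hYY : ∀ i j, K i * ρ * (K j)ᴴ = Y i * (Y j)ᴴ := by
    intro i j
    simp only [Y, hC, conjTranspose_mul, Matrix.mul_assoc]
  simp only [hYY] at hp hρidef hσdef
  have hpn : ∀ i, p i = ∑ q : Fin N × Fin N, ‖Y i q.1 q.2‖^2 := by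
    intro i
    rw [← aux_trn, ← hp]; simp
  have hp0 : ∀ i, 0 ≤ p i := fun i => by rw [hpn]; positivity
  have hpR : ∀ i, Y i * (Y i)ᴴ = (p i : ℂ) • ρi i := by
    intro i
    by_cases h0 : p i = 0
    · have h1 := hpn i
      rw [h0, eq_comm, Finset.sum_eq_zero_iff_of_nonneg (fun _ _ => by positivity)] at h1
      have : Y i = 0 := by
        ext a b
        simpa using h1 (a, b) (Finset.mem_univ _)
      simp [this, h0]
    · rw [hρidef i h0, smul_smul, mul_inv_cancel₀ (by exact_mod_cast h0), one_smul]
  have hM : avg = ∑ j, Y j * (Y j)ᴴ := by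
    rw [havgdef]; exact Finset.sum_congr rfl fun i _ => (hpR i).symm
  have havgP : avg.PosSemidef := by
    rw [hM]
    exact posSemidef_sum _ fun i _ => posSemidef_self_mul_conjTranspose _
  have hσP : σ.PosSemidef := by
    let 𝒴 : Matrix (Fin k) (Fin N × Fin N) ℂ := of fun j q => Y j q.1 q.2
    have : σ = 𝒴 * 𝒴ᴴ := by
      ext a b
      rw [hσdef, aux_tr]
      simp [Matrix.mul_apply, 𝒴]
    rw [this]
    exact posSemidef_self_mul_conjTranspose _
  have hs : ∀ a, 0 ≤ havg.eigenvalues a := havgP.eigenvalues_nonneg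
  have hl : ∀ a, 0 ≤ hσ.eigenvalues a := hσP.eigenvalues_nonneg
  have he : ∀ i, p i ≠ 0 → ∀ b, 0 ≤ (hρiH i).eigenvalues b := by
    intro i h0
    have : (ρi i).PosSemidef := by
      rw [hρidef i h0]
      refine (posSemidef_self_mul_conjTranspose _).smul ?_
      rw [← Complex.ofReal_inv]
      exact_mod_cast inv_nonneg.mpr (hp0 i)
    exact this.eigenvalues_nonneg
  obtain ⟨U, hU', hU, hUσ⟩ := aux_spec hσ
  obtain ⟨Q, hQ', hQ, hQM⟩ := aux_spec havg
  choose V hV' hV hVR using fun i => aux_spec (hρiH i)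
  simp only [vnEntropy]
  set l := hσ.eigenvalues with hldef
  set s := havg.eigenvalues with hsdef
  set e := (fun i => (hρiH i).eigenvalues) with hedef
  change ∀ i, p i ≠ 0 → ∀ b, 0 ≤ e i b at he
  change ∀ i, ρi i = V i * diagonal (fun b => (e i b : ℂ)) * (V i)ᴴ at hVR
  change -∑ a, s a * Real.log (s a) - ∑ i, p i * -∑ b, e i b * Real.log (e i b) ≤
    -∑ c, l c * Real.log (l c)
  clear_value l s e
  have F1 : ∀ i, ∑ c, ‖U i c‖^2 * l c = p i := by
    intro i
    have h := aux_diag U l i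
    rw [← hUσ, hσdef, ← hp] at h
    exact_mod_cast h.symm
  have F2 : ∀ i b, ∑ a, ‖(Qᴴ * V i) a b‖^2 = 1 := by
    intro i b
    apply aux_col
    rw [conjTranspose_mul, conjTranspose_conjTranspose, Matrix.mul_assoc, ← Matrix.mul_assoc Q, hQ,
      Matrix.one_mul, hV']
  have F3 : ∀ i, p i ≠ 0 → (ρi i).trace = 1 := by
    intro i h0
    rw [hρidef i h0, trace_smul, ← hp, smul_eq_mul, inv_mul_cancel₀ (by exact_mod_cast h0)]
  have F4 : ∀ i, p i ≠ 0 → ∑ b, e i b = 1 := by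
    intro i h0
    have h := F3 i h0
    rw [hVR i, trace_mul_comm, ← Matrix.mul_assoc, hV', Matrix.one_mul, trace_diagonal] at h
    exact_mod_cast h
  have F5 : ∀ a, ∑ i, ∑ b, p i * (‖(Qᴴ * V i) a b‖^2 * e i b) = s a := by
    intro a
    have h1 : (Qᴴ * avg * Q) a a = (s a : ℂ) := by
      have : Qᴴ * avg * Q = diagonal (fun c => (s c : ℂ)) := by
        rw [hQM]
        calc _ = (Qᴴ * Q) * diagonal (fun c => (s c : ℂ)) * (Qᴴ * Q) := by
              simp only [Matrix.mul_assoc]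
          _ = _ := by rw [hQ', Matrix.one_mul, Matrix.mul_one]
      rw [this, diagonal_apply_eq]
    have h2 : (Qᴴ * avg * Q) a a = ((∑ i, ∑ b, p i * (‖(Qᴴ * V i) a b‖^2 * e i b) : ℝ) : ℂ) := by
      rw [havgdef, Matrix.mul_sum, Matrix.sum_mul, Matrix.sum_apply, Complex.ofReal_sum]
      refine Finset.sum_congr rfl fun i _ => ?_
      rw [← Finset.mul_sum, Complex.ofReal_mul, ← aux_diag, conjTranspose_mul,
        conjTranspose_conjTranspose, Matrix.mul_smul, Matrix.smul_mul, Matrix.smul_apply,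
        smul_eq_mul]
      congr 2
      conv_lhs => rw [hVR i]
      simp only [Matrix.mul_assoc]
    rw [h1] at h2
    exact_mod_cast h2.symm
  have F6 : ∀ i a b, 0 ≤ p i * (‖(Qᴴ * V i) a b‖^2 * e i b) := by
    intro i a b
    by_cases h0 : p i = 0
    · simp [h0]
    · have := he i h0 b
      have := hp0 i
      positivity
  have F7 : ∀ i a b, p i * (‖(Qᴴ * V i) a b‖^2 * e i b) ≠ 0 → 0 < s a := by
    intro i a b h
    have h1 : 0 < p i * (‖(Qᴴ * V i) a b‖^2 * e i b) := lt_of_le_of_ne (F6 i a b) h.symm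
    rw [← F5 a]
    refine lt_of_lt_of_le h1 ?_
    refine le_trans ?_ (Finset.single_le_sum (f := fun i => ∑ b, p i * (‖(Qᴴ * V i) a b‖^2 * e i b))
      (fun j _ => Finset.sum_nonneg fun b _ => F6 j a b) (Finset.mem_univ i))
    exact Finset.single_le_sum (f := fun b => p i * (‖(Qᴴ * V i) a b‖^2 * e i b))
      (fun b _ => F6 i a b) (Finset.mem_univ b)
  have F8 : ∀ i a b, p i * (‖(Qᴴ * V i) a b‖^2 * e i b) ≠ 0 → 0 < e i b := by
    intro i a b h
    have h0 : p i ≠ 0 := left_ne_zero_of_mul h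
    exact lt_of_le_of_ne (he i h0 b) (right_ne_zero_of_mul (right_ne_zero_of_mul h)).symm
  have main : ∀ i, ∑ c, ‖U i c‖^2 * l c * Real.log (l c) ≤
      ∑ a, ∑ b, p i * (‖(Qᴴ * V i) a b‖^2 * e i b) * (Real.log (s a) - Real.log (e i b)) := by
    intro i
    by_cases h0 : p i = 0
    · have h1 := F1 i
      rw [h0, Finset.sum_eq_zero_iff_of_nonneg (fun c _ => mul_nonneg (by positivity) (hl c))] at h1
      rw [Finset.sum_eq_zero (fun c hc => by rw [h1 c hc, zero_mul])]
      simp [h0]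
    · have h := aux_log (ι := Fin N × Fin N) (κ := Fin k)
        (fun q => p i * (‖(Qᴴ * V i) q.1 q.2‖^2 * e i q.2)) (fun q => s q.1 / e i q.2)
        (fun c => ‖U i c‖^2 * l c) l
        (fun q hq => div_pos (F7 i _ _ hq) (F8 i _ _ hq))
        (fun c hc => lt_of_le_of_ne (hl c) (right_ne_zero_of_mul hc).symm)
        (by
          rw [F1, Fintype.sum_prod_type, Finset.sum_comm]
          simp only [← Finset.mul_sum, ← Finset.sum_mul, F2, one_mul, F4 i h0, mul_one])
        (by
          intro t ht
          have h := aux_D Y σ U l hl hU' hU hσdef hUσ avg (ρi i) Q (V i) hM (p i) t i ht (hpR i)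
            (F3 i h0) s (e i) hs (he i h0) hQ' hQ (hV' i) hQM (hVR i)
          refine le_trans (le_of_eq ?_) h
          rw [Fintype.sum_prod_type, Finset.mul_sum]
          refine Finset.sum_congr rfl fun a _ => ?_
          rw [Finset.mul_sum]
          refine Finset.sum_congr rfl fun b _ => ?_
          by_cases hz : e i b = 0
          · simp [hz]
          · have hpos : 0 < e i b := lt_of_le_of_ne (he i h0 b) (Ne.symm hz)
            have h1 : s a / e i b + t ≠ 0 := by
              have := div_nonneg (hs a) hpos.le
              linarith
            have h2 : s a + t * e i b ≠ 0 := by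
              have := mul_pos ht hpos
              have := hs a
              linarith
            have h3 : s a / e i b + t = (s a + t * e i b) / e i b := by field_simp
            simp only [h3]
            field_simp)
      refine h.trans (le_of_eq ?_)
      rw [Fintype.sum_prod_type]
      refine Finset.sum_congr rfl fun a _ => Finset.sum_congr rfl fun b _ => ?_
      by_cases hz : p i * (‖(Qᴴ * V i) a b‖^2 * e i b) = 0
      · simp only [hz, zero_mul]
      · simp only [Real.log_div (F7 i _ _ hz).ne' (F8 i _ _ hz).ne']
  have tot := Finset.sum_le_sum fun i (_ : i ∈ Finset.univ) => main i
  have G1 : ∑ i, ∑ c, ‖U i c‖^2 * l c * Real.log (l c) = ∑ c, l c * Real.log (l c) := by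
    rw [Finset.sum_comm]
    refine Finset.sum_congr rfl fun c _ => ?_
    rw [← Finset.sum_mul, ← Finset.sum_mul, aux_col U hU', one_mul]
  have G2 : ∑ i, ∑ a, ∑ b, p i * (‖(Qᴴ * V i) a b‖^2 * e i b) * (Real.log (s a) - Real.log (e i b))
      = ∑ a, s a * Real.log (s a) - ∑ i, p i * ∑ b, e i b * Real.log (e i b) := by
    simp only [mul_sub, Finset.sum_sub_distrib]
    congr 1
    · rw [Finset.sum_comm]
      refine Finset.sum_congr rfl fun a _ => ?_
      simp only [← Finset.sum_mul]
      rw [F5]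
    · refine Finset.sum_congr rfl fun i _ => ?_
      rw [Finset.sum_comm, Finset.mul_sum]
      refine Finset.sum_congr rfl fun b _ => ?_
      rw [← Finset.sum_mul, ← Finset.mul_sum, ← Finset.sum_mul, F2, one_mul, mul_assoc]
  rw [G1, G2] at tot
  simp only [mul_neg, Finset.sum_neg_distrib]
  linarith
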